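/- For all integers a ≥ 2 and all integers n ≥ 124, ex_Π(n, 5, 10a + 5) = Π_{2,1}(a, n). (Here 10a + 5 = C(5,2)·a + 5 = Σ_{2,1}(a,5).) -/

import Mathlib

open Finset

/-- Sum of the edge multiplicities of the multigraph `w` inside the vertex set `X`
(edges are 2-element subsets of `Fin n`). -/
def edgeSum (n : ℕ) (w : Finset (Fin n) → ℕ) (X : Finset (Fin n)) : ℕ :=
  ∑ p ∈ X.powersetCard 2, w p

/-- Product of the edge multiplicities of the multigraph `w` inside the vertex set `X`. -/
def edgeProd (n : ℕ) (w : Finset (Fin n) → ℕ) (X : Finset (Fin n)) : ℕ :=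
  ∏ p ∈ X.powersetCard 2, w p

/-- The product-degree of the vertex `v` in the multigraph `w`. -/
def pdeg (n : ℕ) (w : Finset (Fin n) → ℕ) (v : Fin n) : ℕ :=
  ∏ u ∈ Finset.univ.erase v, w {u, v}

/-- `w` is an `(n,s,q)`-graph: every `s`-set of vertices spans at most `q` edges. -/
def IsF (n s q : ℕ) (w : Finset (Fin n) → ℕ) : Prop :=
  ∀ X : Finset (Fin n), X.card = s → edgeSum n w X ≤ q

/-- `ex_Π(n,s,q)`: the maximum of the product of all edge multiplicities over
`(n,s,q)`-graphs. -/
noncomputable def exPi (n s q : ℕ) : ℕ :=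
  sSup {P | ∃ w : Finset (Fin n) → ℕ, IsF n s q w ∧ P = edgeProd n w Finset.univ}

/-- Membership in the family `T_{r,d}(a,n)`: the vertex set can be partitioned into
parts `V_0, …, V_{r-1}` (given by a labelling `f`) so that edges inside `V_0` have
multiplicity `a - d`, edges inside `V_i` (`i ≥ 1`) have multiplicity `a`, and edges
between distinct parts have multiplicity `a + 1`. -/
def InT (n r d a : ℕ) (w : Finset (Fin n) → ℕ) : Prop :=
  ∃ f : Fin n → ℕ, (∀ v, f v < r) ∧
    ∀ u v : Fin n, u ≠ v →
      w {u, v} = if f u = f v then (if f u = 0 then a - d else a) else a + 1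

/-- `Σ_{r,d}(a,n)`: the maximum number of edges of a member of `T_{r,d}(a,n)`. -/
noncomputable def SigmaT (r d a n : ℕ) : ℕ :=
  sSup {e | ∃ w : Finset (Fin n) → ℕ, InT n r d a w ∧ e = edgeSum n w Finset.univ}

/-- `Π_{r,d}(a,n)`: the maximum product of edge multiplicities of a member of
`T_{r,d}(a,n)`. -/
noncomputable def PiT (r d a n : ℕ) : ℕ :=
  sSup {P | ∃ w : Finset (Fin n) → ℕ, InT n r d a w ∧ P = edgeProd n w Finset.univ}

/-- The sum of `f` over the two-element subsets of `X`. -/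
def pairSum {V M : Type*} [AddCommMonoid M] (f : Finset V → M) (X : Finset V) : M :=
  ∑ p ∈ X.powersetCard 2, f p

section PairSum

variable {V M : Type*} [AddCommMonoid M]

lemma pairSum_empty (f : Finset V → M) : pairSum f ∅ = 0 := by
  rw [pairSum, Finset.powersetCard_eq_empty.2 (by simp), Finset.sum_empty]

lemma pairSum_singleton (f : Finset V → M) (v : V) : pairSum f {v} = 0 := by
  rw [pairSum, Finset.powersetCard_eq_empty.2 (by simp), Finset.sum_empty]

variable [DecidableEq V]

lemma pairSum_insert (f : Finset V → M) {v : V} {X : Finset V} (hv : v ∉ X) :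
    pairSum f (insert v X) = pairSum f X + ∑ u ∈ X, f {v, u} := by
  have h1 : Disjoint (X.powersetCard 2) ((X.powersetCard 1).image (insert v)) := by
    rw [Finset.disjoint_left]
    intro p hp hp'
    obtain ⟨q, -, rfl⟩ := Finset.mem_image.1 hp'
    exact hv ((Finset.mem_powersetCard.1 hp).1 (Finset.mem_insert_self v q))
  unfold pairSum
  rw [Finset.powersetCard_succ_insert hv, Finset.sum_union h1, Finset.sum_image,
    Finset.powersetCard_one, Finset.sum_map]
  · rfl
  · intro p hp q hq hpq
    have hvp : v ∉ p := fun h => hv ((Finset.mem_powersetCard.1 hp).1 h)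
    have hvq : v ∉ q := fun h => hv ((Finset.mem_powersetCard.1 hq).1 h)
    rw [← Finset.erase_insert hvp, ← Finset.erase_insert hvq, hpq]

lemma pairSum_erase (f : Finset V → M) {v : V} {X : Finset V} (hv : v ∈ X) :
    pairSum f X = pairSum f (X.erase v) + ∑ u ∈ X.erase v, f {v, u} := by
  conv_lhs => rw [← Finset.insert_erase hv]
  exact pairSum_insert f (Finset.notMem_erase v X)

lemma pairSum_union (f : Finset V → M) {X Y : Finset V} (h : Disjoint X Y) :
    pairSum f (X ∪ Y) = pairSum f X + pairSum f Y + ∑ y ∈ Y, ∑ x ∈ X, f {y, x} := by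
  induction Y using Finset.induction_on with
  | empty => simp [pairSum_empty]
  | insert v Y hv ih =>
    rw [Finset.disjoint_insert_right] at h
    have hv' : v ∉ X ∪ Y := by simp [h.1, hv]
    rw [Finset.union_insert, pairSum_insert f hv', pairSum_insert f hv, ih h.2,
      Finset.sum_union h.2, Finset.sum_insert hv]
    abel

lemma pairSum_sdiff (f : Finset V → M) {X S : Finset V} (h : S ⊆ X) :
    pairSum f X = pairSum f S + pairSum f (X \ S) + ∑ z ∈ X \ S, ∑ s ∈ S, f {z, s} := by
  conv_lhs => rw [← Finset.union_sdiff_of_subset h]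
  exact pairSum_union f Finset.disjoint_sdiff

lemma pairSum_pair (f : Finset V → M) {u v : V} (h : u ≠ v) :
    pairSum f {u, v} = f {u, v} := by
  rw [pairSum_insert f (by simpa using h), pairSum_singleton]
  simp

lemma pairSum_const {f : Finset V → M} {X : Finset V} {A : M}
    (h : ∀ u ∈ X, ∀ v ∈ X, u ≠ v → f {u, v} = A) :
    pairSum f X = (X.card.choose 2) • A := by
  rw [← Finset.card_powersetCard, ← Finset.sum_const]
  refine Finset.sum_congr rfl fun p hp => ?_
  obtain ⟨hpX, hp2⟩ := Finset.mem_powersetCard.1 hp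
  obtain ⟨u, v, huv, rfl⟩ := Finset.card_eq_two.1 hp2
  exact h u (hpX (by simp)) v (hpX (by simp)) huv

lemma sum_pairSum_erase (f : Finset V → M) (X : Finset V) :
    ∑ v ∈ X, pairSum f (X.erase v) = (X.card - 2) • pairSum f X := by
  unfold pairSum
  rw [Finset.sum_comm' (s' := fun p => X \ p) (t' := X.powersetCard 2), Finset.smul_sum]
  · refine Finset.sum_congr rfl fun p hp => ?_
    obtain ⟨hpX, hp2⟩ := Finset.mem_powersetCard.1 hp
    rw [Finset.sum_const, Finset.card_sdiff_of_subset hpX, hp2]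
  · intro v p
    simp only [Finset.mem_powersetCard, Finset.subset_erase, Finset.mem_sdiff]
    tauto

lemma pairSum_le_of_card_succ {f : Finset V → ℤ} {X : Finset V} {k : ℕ} {q : ℤ}
    (hX : X.card = k + 1) (h : ∀ Y ⊆ X, Y.card = k → pairSum f Y ≤ q) :
    ((k - 1 : ℕ) : ℤ) * pairSum f X ≤ (k + 1) * q := by
  have h1 := sum_pairSum_erase f X
  have h2 : ∑ v ∈ X, pairSum f (X.erase v) ≤ ∑ _v ∈ X, q :=
    Finset.sum_le_sum fun v hv => h _ (Finset.erase_subset v X) (by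
      rw [Finset.card_erase_of_mem hv, hX]; rfl)
  rw [h1, Finset.sum_const, hX] at h2
  simpa using h2

lemma pairSum_triple (f : Finset V → M) {u v x : V} (huv : u ≠ v) (hux : u ≠ x) (hvx : v ≠ x) :
    pairSum f {u, v, x} = f {v, x} + (f {u, v} + f {u, x}) := by
  rw [pairSum_insert f (by simp [huv, hux]), pairSum_pair f hvx, Finset.sum_pair hvx]

lemma pairSum_quad (f : Finset V → M) {u v x y : V} (huv : u ≠ v) (hux : u ≠ x) (huy : u ≠ y)
    (hvx : v ≠ x) (hvy : v ≠ y) (hxy : x ≠ y) :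
    pairSum f {u, v, x, y} =
      f {x, y} + (f {v, x} + f {v, y}) + (f {u, v} + (f {u, x} + f {u, y})) := by
  rw [pairSum_insert f (by simp [huv, hux, huy]), pairSum_triple f hvx hvy hxy,
    Finset.sum_insert (by simp [hvx, hvy]), Finset.sum_pair hxy]

end PairSum

/-- The normalised logarithm of the edge product of a two-part pattern with parts of sizes
`x` and `y`: weight `-β` inside the first part, `0` inside the second, `α` across. -/
noncomputable def splitWeight (α β : ℝ) (x y : ℕ) : ℝ :=
  α * x * y - β * (x * (x - 1) / 2)

/-- `lam` is a real edge weight controlled by the integer edge excess `c`. -/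
structure IsLogWeight {V : Type*} (c : Finset V → ℤ) (lam : Finset V → ℝ) (α β : ℝ) : Prop where
  pos : 0 < α
  le : α ≤ β
  four_mul_le : 4 * β ≤ 7 * α
  lam_le : ∀ p, lam p ≤ α * c p
  lam_le_neg : ∀ p, c p ≤ -1 → lam p ≤ -β

/-- No dense pair, triple or quadruple, and no path on four vertices whose
remaining three pairs all have excess zero. -/
structure IsLocallySparse {V : Type*} [DecidableEq V] (c : Finset V → ℤ) (X : Finset V) :
    Prop where
  pair_le : ∀ u ∈ X, ∀ v ∈ X, u ≠ v → c {u, v} ≤ 1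
  triple_le : ∀ u ∈ X, ∀ v ∈ X, ∀ x ∈ X, u ≠ v → u ≠ x → v ≠ x →
    c {v, x} + (c {u, v} + c {u, x}) ≤ 2
  quad_le : ∀ u ∈ X, ∀ v ∈ X, ∀ x ∈ X, ∀ y ∈ X, u ≠ v → u ≠ x → u ≠ y → v ≠ x → v ≠ y → x ≠ y →
    c {x, y} + (c {v, x} + c {v, y}) + (c {u, v} + (c {u, x} + c {u, y})) ≤ 3
  no_path : ∀ u ∈ X, ∀ v ∈ X, ∀ x ∈ X, ∀ y ∈ X,
    u ≠ v → u ≠ x → u ≠ y → v ≠ x → v ≠ y → x ≠ y →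
    c {u, v} = 1 → c {v, x} = 1 → c {x, y} = 1 → c {u, x} = 0 → c {v, y} = 0 → c {u, y} ≠ 0

section Abstract

variable {V : Type*} {c : Finset V → ℤ} {lam : Finset V → ℝ} {α β : ℝ}

lemma IsLogWeight.lam_le_of_le (h : IsLogWeight c lam α β) {p : Finset V} {k : ℤ}
    (hk : c p ≤ k) : lam p ≤ α * k :=
  (h.lam_le p).trans (mul_le_mul_of_nonneg_left (by exact_mod_cast hk) h.pos.le)

lemma IsLogWeight.pairSum_le (h : IsLogWeight c lam α β) (X : Finset V) :
    pairSum lam X ≤ α * pairSum c X := by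
  unfold pairSum
  push_cast
  rw [Finset.mul_sum]
  exact Finset.sum_le_sum fun p _ => h.lam_le p

variable [DecidableEq V]

lemma IsLocallySparse.mono {X Y : Finset V} (h : IsLocallySparse c X) (hYX : Y ⊆ X) :
    IsLocallySparse c Y where
  pair_le u hu v hv := h.pair_le u (hYX hu) v (hYX hv)
  triple_le u hu v hv x hx := h.triple_le u (hYX hu) v (hYX hv) x (hYX hx)
  quad_le u hu v hv x hx y hy := h.quad_le u (hYX hu) v (hYX hv) x (hYX hx) y (hYX hy)
  no_path u hu v hv x hx y hy := h.no_path u (hYX hu) v (hYX hv) x (hYX hx) y (hYX hy)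

lemma exists_max_splitWeight (hα : 0 < α) (hβ : 4 * β ≤ 7 * α) (m : ℕ) :
    ∃ x y : ℕ, x + y = m ∧
      (∀ x' y' : ℕ, x' + y' = m → splitWeight α β x' y' ≤ splitWeight α β x y) ∧
      4 * m ≤ 15 * x + 4 := by
  obtain ⟨⟨x, y⟩, hxy, hmax⟩ := Finset.exists_max_image (Finset.HasAntidiagonal.antidiagonal m)
    (fun p => splitWeight α β p.1 p.2) ⟨(0, m), by simp⟩
  simp only [Finset.HasAntidiagonal.mem_antidiagonal, Prod.forall] at hxy hmax
  refine ⟨x, y, hxy, hmax, ?_⟩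
  rcases y with _ | t
  · omega
  · have h := hmax (x + 1) t (by omega)
    unfold splitWeight at h
    push_cast at h
    have h1 : α * t ≤ (α + β) * x := by nlinarith
    have h2 : α * (4 * t) ≤ α * (11 * x) := by
      have : (0 : ℝ) ≤ x := Nat.cast_nonneg x
      nlinarith
    have h3 : (4 * t : ℝ) ≤ 11 * x := le_of_mul_le_mul_left h2 hα
    have h4 : 4 * t ≤ 11 * x := by exact_mod_cast h3
    omega

lemma erase_eq_insert_sdiff {X : Finset V} {u v t : V} (hv : v ∈ X) (ht : t ∈ X)
    (huv : u ≠ v) (hut : u ≠ t) :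
    X.erase u = insert v (insert t (X \ {u, v, t})) := by
  ext z
  simp only [Finset.mem_erase, Finset.mem_insert, Finset.mem_sdiff, Finset.mem_singleton, not_or]
  constructor
  · tauto
  · rintro (rfl | rfl | h)
    · exact ⟨huv.symm, hv⟩
    · exact ⟨hut.symm, ht⟩
    · exact ⟨h.2.1, h.1⟩

lemma pairSum_le_splitWeight_of_isLocallySparse (h : IsLogWeight c lam α β) :
    ∀ (n : ℕ) (X : Finset V), X.card = n → IsLocallySparse c X →
      ∃ x y : ℕ, x + y = n ∧ pairSum lam X ≤ splitWeight α β x y := by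
  intro n
  induction n with
  | zero =>
    intro X hX _
    refine ⟨0, 0, rfl, ?_⟩
    rw [Finset.card_eq_zero.1 hX, pairSum_empty]
    simp [splitWeight]
  | succ m ih =>
    intro X hX hR
    have hα := h.pos
    obtain ⟨x, y, hxy, hmax, hx⟩ := exists_max_splitWeight h.pos h.four_mul_le m
    have key : ∀ v ∈ X, pairSum lam X ≤
        splitWeight α β x y + ∑ z ∈ X.erase v, lam {v, z} := by
      intro v hv
      obtain ⟨x', y', hxy', hle⟩ := ih (X.erase v) (by rw [Finset.card_erase_of_mem hv]; omega)
        (hR.mono (Finset.erase_subset v X))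
      rw [pairSum_erase lam hv]
      linarith [hmax x' y' hxy']
    have hxyR : (x : ℝ) + y = m := by exact_mod_cast hxy
    by_cases hH : ∃ u ∈ X, ∃ v ∈ X, u ≠ v ∧ c {u, v} = 1
    swap
    · refine ⟨0, m + 1, by omega, ?_⟩
      have : pairSum lam X ≤ 0 := by
        refine Finset.sum_nonpos fun p hp => ?_
        obtain ⟨hpX, hp2⟩ := Finset.mem_powersetCard.1 hp
        obtain ⟨u, v, huv, rfl⟩ := Finset.card_eq_two.1 hp2
        have hu := hpX (Finset.mem_insert_self u {v})
        have hv := hpX (Finset.mem_insert_of_mem (a := v) (b := u) (Finset.mem_singleton_self v))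
        have h1 := hR.pair_le u hu v hv huv
        have h2 : c {u, v} ≠ 1 := fun h3 => hH ⟨u, hu, v, hv, huv, h3⟩
        simpa using h.lam_le_of_le (p := {u, v}) (k := 0) (by omega)
      simpa [splitWeight] using this
    by_cases hP : ∃ u ∈ X, ∃ v ∈ X, ∃ t ∈ X, u ≠ v ∧ u ≠ t ∧ v ≠ t ∧
        c {u, v} = 1 ∧ c {v, t} = 1 ∧ c {u, t} = 0
    · obtain ⟨u, hu, v, hv, t, ht, huv, hut, hvt, cuv, cvt, cut⟩ := hP
      set S : Finset V := X \ {u, v, t} with hS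
      have hST : ({u, v, t} : Finset V) ⊆ X := by
        intro z hz
        simp only [Finset.mem_insert, Finset.mem_singleton] at hz
        rcases hz with rfl | rfl | rfl <;> assumption
      have hScard : S.card + 3 = m + 1 := by
        rw [hS, Finset.card_sdiff_of_subset hST, hX]
        have h3 : ({u, v, t} : Finset V).card = 3 := Finset.card_eq_three.2
          ⟨u, v, t, huv, hut, hvt, rfl⟩
        have := Finset.card_le_card hST
        omega
      have hSmem : ∀ z ∈ S, z ∈ X ∧ z ≠ u ∧ z ≠ v ∧ z ≠ t := by
        intro z hz
        simpa [hS, Finset.mem_sdiff] using hz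
      have eu : X.erase u = insert v (insert t S) := erase_eq_insert_sdiff hv ht huv hut
      have ev : X.erase v = insert u (insert t S) := by
        rw [hS, Finset.insert_comm u v]
        exact erase_eq_insert_sdiff hu ht huv.symm hvt
      have et : X.erase t = insert u (insert v S) := by
        rw [hS, show ({u, v, t} : Finset V) = {t, u, v} by
          rw [Finset.pair_comm v t, Finset.insert_comm u t]]
        exact erase_eq_insert_sdiff hu hv hut.symm hvt.symm
      have hsum : ∀ p q r : V, p ≠ q → p ∉ S → q ∉ S →
          ∑ z ∈ insert p (insert q S), lam {r, z} =
            lam {r, p} + (lam {r, q} + ∑ z ∈ S, lam {r, z}) := by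
        intro p q r hpq hp hq
        rw [Finset.sum_insert (by simp [hpq, hp]), Finset.sum_insert hq]
      have huS : u ∉ S := by simp [hS]
      have hvS : v ∉ S := by simp [hS]
      have htS : t ∉ S := by simp [hS]
      have ku := key u hu
      have kv := key v hv
      have kt := key t ht
      rw [eu, hsum v t u hvt hvS htS] at ku
      rw [ev, hsum u t v hut huS htS] at kv
      rw [et, hsum u v t huv huS hvS] at kt
      have luv := h.lam_le_of_le cuv.le
      have lvt := h.lam_le_of_le cvt.le
      have lut := h.lam_le_of_le cut.le
      rw [Finset.pair_comm v u] at kv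
      rw [Finset.pair_comm t u, Finset.pair_comm t v] at kt
      set B := S.filter (fun z => c {v, z} ≤ -1) with hB
      have hBcard : B.card ≤ S.card := Finset.card_filter_le _ _
      set D := S.filter (fun z => ¬ c {v, z} ≤ -1) with hD
      have hcomp : D.card + B.card = S.card := by
        rw [add_comm]; exact Finset.card_filter_add_card_filter_not _
      have split : ∀ (g : V → ℝ) (p q : ℝ), (∀ z ∈ S, c {v, z} ≤ -1 → g z ≤ p) →
          (∀ z ∈ S, ¬ c {v, z} ≤ -1 → g z ≤ q) →
          ∑ z ∈ S, g z ≤ B.card * p + (m - 2 - B.card) * q := by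
        intro g p q h1 h2
        rw [← Finset.sum_filter_add_sum_filter_not S (fun z => c {v, z} ≤ -1)]
        have e : (D.card : ℝ) = m - 2 - B.card := by
          have : (D.card : ℝ) + B.card + 3 = m + 1 := by
            exact_mod_cast (by omega)
          linarith
        rw [← e, ← nsmul_eq_mul, ← nsmul_eq_mul]
        refine add_le_add (Finset.sum_le_card_nsmul _ _ _ fun z hz => ?_)
          (Finset.sum_le_card_nsmul _ _ _ fun z hz => ?_)
        · exact h1 z (Finset.mem_filter.1 hz).1 (Finset.mem_filter.1 hz).2
        · exact h2 z (Finset.mem_filter.1 hz).1 (Finset.mem_filter.1 hz).2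
      have sv : ∑ z ∈ S, lam {v, z} ≤ B.card * (-β) + (m - 2 - B.card) * α := by
        refine split _ _ _ (fun z _ hz => h.lam_le_neg _ hz) (fun z hz _ => ?_)
        obtain ⟨hzX, hzu, hzv, hzt⟩ := hSmem z hz
        simpa using h.lam_le_of_le (hR.pair_le v hv z hzX hzv.symm)
      have sut : ∑ z ∈ S, (lam {u, z} + lam {t, z}) ≤
          B.card * (2 * α) + (m - 2 - B.card) * 0 := by
        refine split _ _ _ (fun z hz _ => ?_) (fun z hz hvz => ?_)
        · obtain ⟨hzX, hzu, hzv, hzt⟩ := hSmem z hz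
          have h1 := h.lam_le_of_le (hR.pair_le u hu z hzX hzu.symm)
          have h2 := h.lam_le_of_le (hR.pair_le t ht z hzX hzt.symm)
          push_cast at h1 h2
          linarith
        · obtain ⟨hzX, hzu, hzv, hzt⟩ := hSmem z hz
          have pu := hR.pair_le u hu z hzX hzu.symm
          have pt := hR.pair_le t ht z hzX hzt.symm
          have t1 := hR.triple_le z hzX u hu v hv hzu hzv huv
          have t2 := hR.triple_le z hzX v hv t ht hzv hzt hvt
          have q := hR.quad_le z hzX u hu v hv t ht hzu hzv hzt huv hut hvt
          have n1 := hR.no_path z hzX u hu v hv t ht hzu hzv hzt huv hut hvt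
          have n2 := hR.no_path z hzX t ht v hv u hu hzt hzv hzu hvt.symm hut.symm huv.symm
          rw [Finset.pair_comm t v, Finset.pair_comm v u, Finset.pair_comm t u] at n2
          rw [Finset.pair_comm z u, Finset.pair_comm z v] at t1
          rw [Finset.pair_comm z t, Finset.pair_comm z v] at t2
          rw [Finset.pair_comm z t, Finset.pair_comm z v, Finset.pair_comm z u] at q n1 n2
          have hzcases : (c {u, z} ≤ 0 ∧ c {t, z} ≤ 0) ∨ (c {u, z} ≤ 1 ∧ c {t, z} ≤ -1) ∨
              (c {u, z} ≤ -1 ∧ c {t, z} ≤ 1) := by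
            by_cases hv0 : c {v, z} = 0
            · by_cases a1 : c {u, z} = 1
              · have := n1 a1 cuv cvt hv0 cut
                omega
              · by_cases a2 : c {t, z} = 1
                · have := n2 a2 cvt cuv hv0 cut
                  omega
                · omega
            · omega
          have hβ := h.le
          rcases hzcases with ⟨a1, a2⟩ | ⟨a1, a2⟩ | ⟨a1, a2⟩
          · have h1 := h.lam_le_of_le a1
            have h2 := h.lam_le_of_le a2
            push_cast at h1 h2
            linarith
          · have h1 := h.lam_le_of_le a1
            have h2 := h.lam_le_neg _ a2
            push_cast at h1
            linarith
          · have h1 := h.lam_le_neg _ a1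
            have h2 := h.lam_le_of_le a2
            push_cast at h2
            linarith
      rw [Finset.sum_add_distrib] at sut
      push_cast at luv lvt lut
      by_cases hBx : B.card + 1 ≤ x
      · refine ⟨x, y + 1, by omega, ?_⟩
        have e : splitWeight α β x (y + 1) = splitWeight α β x y + α * x := by
          unfold splitWeight; push_cast; ring
        rw [e]
        have : α * (B.card + 1) ≤ α * x :=
          mul_le_mul_of_nonneg_left (by exact_mod_cast hBx) hα.le
        linarith
      · refine ⟨x + 1, y, by omega, ?_⟩
        have e : splitWeight α β (x + 1) y = splitWeight α β x y + α * y - β * x := by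
          unfold splitWeight; push_cast; ring
        rw [e]
        have hb : (x : ℝ) ≤ B.card := by exact_mod_cast (by omega)
        have : (α + β) * x ≤ (α + β) * B.card :=
          mul_le_mul_of_nonneg_left hb (by linarith [h.le])
        have hy : α * y = α * m - α * x := by rw [← hxyR]; ring
        linarith
    · obtain ⟨u, hu, v, hv, huv, cuv⟩ := hH
      have luv := h.lam_le_of_le cuv.le
      push_cast at luv
      have ku := key u hu
      have kv := key v hv
      have hvu : v ∈ X.erase u := by simp [huv.symm, hv]
      have huv' : u ∈ X.erase v := by simp [huv, hu]
      rw [← Finset.add_sum_erase _ _ hvu] at ku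
      rw [← Finset.add_sum_erase _ _ huv', Finset.erase_right_comm, Finset.pair_comm v u] at kv
      have hs : ∑ z ∈ (X.erase u).erase v, (lam {u, z} + lam {v, z}) ≤ 0 := by
        refine Finset.sum_nonpos fun z hz => ?_
        simp only [Finset.mem_erase] at hz
        obtain ⟨hzv, hzu, hzX⟩ := hz
        have pu := hR.pair_le u hu z hzX hzu.symm
        have pv := hR.pair_le v hv z hzX hzv.symm
        have t1 := hR.triple_le u hu v hv z hzX huv hzu.symm hzv.symm
        have n1 : ¬ (c {u, z} = 1 ∧ c {v, z} = 0) := fun hh => hP ⟨z, hzX, u, hu, v, hv, hzu, hzv,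
          huv, by rw [Finset.pair_comm]; exact hh.1, cuv, by rw [Finset.pair_comm]; exact hh.2⟩
        have n2 : ¬ (c {v, z} = 1 ∧ c {u, z} = 0) := fun hh => hP ⟨z, hzX, v, hv, u, hu, hzv, hzu,
          huv.symm, by rw [Finset.pair_comm]; exact hh.1, by rw [Finset.pair_comm]; exact cuv,
          by rw [Finset.pair_comm]; exact hh.2⟩
        have hβ := h.le
        have hzcases : (c {u, z} ≤ 0 ∧ c {v, z} ≤ 0) ∨ (c {u, z} ≤ 1 ∧ c {v, z} ≤ -1) ∨
            (c {u, z} ≤ -1 ∧ c {v, z} ≤ 1) := by omega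
        rcases hzcases with ⟨a1, a2⟩ | ⟨a1, a2⟩ | ⟨a1, a2⟩
        · have h1 := h.lam_le_of_le a1
          have h2 := h.lam_le_of_le a2
          push_cast at h1 h2
          linarith
        · have h1 := h.lam_le_of_le a1
          have h2 := h.lam_le_neg _ a2
          push_cast at h1
          linarith
        · have h1 := h.lam_le_neg _ a1
          have h2 := h.lam_le_of_le a2
          push_cast at h2
          linarith
      rw [Finset.sum_add_distrib] at hs
      have hle : pairSum lam X ≤ splitWeight α β x y + α := by linarith
      rcases Nat.eq_zero_or_pos x with rfl | hx0
      · have hm : 0 < m := by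
          have : 1 < X.card := Finset.one_lt_card.2 ⟨u, hu, v, hv, huv⟩
          omega
        have hy1 : y = 1 := by omega
        subst hy1
        refine ⟨1, 1, by omega, hle.trans ?_⟩
        simp [splitWeight]
      · refine ⟨x, y + 1, by omega, hle.trans ?_⟩
        have e : splitWeight α β x (y + 1) = splitWeight α β x y + α * x := by
          unfold splitWeight; push_cast; ring
        have : α * 1 ≤ α * x := mul_le_mul_of_nonneg_left (by exact_mod_cast hx0) hα.le
        linarith

lemma pairSum_le_of_subset (h : IsLogWeight c lam α β) {X S : Finset V} (hS : S ⊆ X) {W : ℤ}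
    (hW : pairSum c S + ∑ z ∈ X \ S, ∑ s ∈ S, c {z, s} ≤ W) :
    pairSum lam X ≤ pairSum lam (X \ S) + α * W := by
  rw [pairSum_sdiff lam hS]
  have h1 := h.pairSum_le S
  have h2 : ∑ z ∈ X \ S, ∑ s ∈ S, lam {z, s} ≤
      α * ((∑ z ∈ X \ S, ∑ s ∈ S, c {z, s} : ℤ) : ℝ) := by
    push_cast
    simp only [Finset.mul_sum]
    exact Finset.sum_le_sum fun z _ => Finset.sum_le_sum fun s _ => h.lam_le _
  have h3 : α * ((pairSum c S + ∑ z ∈ X \ S, ∑ s ∈ S, c {z, s} : ℤ) : ℝ) ≤ α * W :=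
    mul_le_mul_of_nonneg_left (by exact_mod_cast hW) h.pos.le
  push_cast at h2 h3
  linarith

lemma pairSum_add_cross_le {X S : Finset V} {k : ℕ} {q r : ℤ}
    (hq : ∀ Y ⊆ X, Y.card = k + 1 → pairSum c Y ≤ q) (hS : S ⊆ X) (hk : S.card = k)
    (hr : r ≤ pairSum c S) (hm : 1 ≤ (X \ S).card) :
    pairSum c S + ∑ z ∈ X \ S, ∑ s ∈ S, c {z, s} ≤ r + (X \ S).card * (q - r) := by
  have h1 : ∑ z ∈ X \ S, ∑ s ∈ S, c {z, s} ≤ (X \ S).card • (q - pairSum c S) := by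
    refine Finset.sum_le_card_nsmul _ _ _ fun z hz => ?_
    obtain ⟨hzX, hzS⟩ := Finset.mem_sdiff.1 hz
    have := hq (insert z S) (Finset.insert_subset hzX hS) (by
      rw [Finset.card_insert_of_notMem hzS, hk])
    rw [pairSum_insert c hzS] at this
    linarith
  rw [nsmul_eq_mul] at h1
  have hm' : (1 : ℤ) ≤ (X \ S).card := by exact_mod_cast hm
  nlinarith

/-- The loss, in units of `α / 8`, allowed for sets of size `n`. -/
def slack (n : ℕ) : ℕ := min (2 * n) (120 - n)

lemma splitWeight_add_right_le (hα : 0 < α) {x y j W e e' : ℕ}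
    (hle : e + 8 * W ≤ 8 * (j * x) + e') :
    8 * splitWeight α β x y + α * e + 8 * (α * W) ≤ 8 * splitWeight α β x (y + j) + α * e' := by
  have h1 : α * (e + 8 * W) ≤ α * (8 * (j * x) + e') :=
    mul_le_mul_of_nonneg_left (by exact_mod_cast hle) hα.le
  unfold splitWeight
  push_cast
  linarith

lemma splitWeight_succ_add_le (hα : 0 < α) (hβ : 4 * β ≤ 7 * α) {x y j W e e' : ℕ}
    (hle : e + 8 * W + 14 * x ≤ 8 * (y + j * x + j) + e') :
    8 * splitWeight α β x y + α * e + 8 * (α * W) ≤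
      8 * splitWeight α β (x + 1) (y + j) + α * e' := by
  have h1 : α * (e + 8 * W + 14 * x) ≤ α * (8 * (y + j * x + j) + e') :=
    mul_le_mul_of_nonneg_left (by exact_mod_cast hle) hα.le
  have h2 : 4 * β * x ≤ 7 * α * x := mul_le_mul_of_nonneg_right hβ (Nat.cast_nonneg x)
  unfold splitWeight
  push_cast
  linarith

lemma pairSum_le_of_card_le_nine (h : IsLogWeight c lam α β) {X : Finset V} (h5 : 5 ≤ X.card)
    (h9 : X.card ≤ 9) (hc : ∀ Y ⊆ X, Y.card = 5 → pairSum c Y ≤ 5) :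
    ∃ x y : ℕ, x + y = X.card ∧
      8 * pairSum lam X ≤ 8 * splitWeight α β x y + α * slack X.card := by
  have c6 : ∀ Y ⊆ X, Y.card = 6 → pairSum c Y ≤ 7 := fun Y hY hY6 => by
    have := pairSum_le_of_card_succ (k := 5) hY6 fun Z hZ => hc Z (hZ.trans hY)
    norm_num at this
    omega
  have c7 : ∀ Y ⊆ X, Y.card = 7 → pairSum c Y ≤ 9 := fun Y hY hY6 => by
    have := pairSum_le_of_card_succ (k := 6) hY6 fun Z hZ => c6 Z (hZ.trans hY)
    norm_num at this
    omega
  have c8 : ∀ Y ⊆ X, Y.card = 8 → pairSum c Y ≤ 12 := fun Y hY hY6 => by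
    have := pairSum_le_of_card_succ (k := 7) hY6 fun Z hZ => c7 Z (hZ.trans hY)
    norm_num at this
    omega
  have c9 : ∀ Y ⊆ X, Y.card = 9 → pairSum c Y ≤ 15 := fun Y hY hY6 => by
    have := pairSum_le_of_card_succ (k := 8) hY6 fun Z hZ => c8 Z (hZ.trans hY)
    norm_num at this
    omega
  have hα := h.pos
  have hβ := h.four_mul_le
  have hl := h.pairSum_le X
  have hb : ∀ q : ℤ, pairSum c X ≤ q → pairSum lam X ≤ α * q := fun q hq =>
    hl.trans (mul_le_mul_of_nonneg_left (by exact_mod_cast hq) hα.le)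
  obtain h' | h' | h' | h' | h' : X.card = 5 ∨ X.card = 6 ∨ X.card = 7 ∨ X.card = 8 ∨
      X.card = 9 := by omega
  all_goals rw [h']
  · have := hb _ (hc X subset_rfl h')
    refine ⟨2, 3, rfl, ?_⟩
    norm_num [splitWeight, slack] at this ⊢
    linarith
  · have := hb _ (c6 X subset_rfl h')
    refine ⟨2, 4, rfl, ?_⟩
    norm_num [splitWeight, slack] at this ⊢
    linarith
  · have := hb _ (c7 X subset_rfl h')
    refine ⟨2, 5, rfl, ?_⟩
    norm_num [splitWeight, slack] at this ⊢
    linarith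
  · have := hb _ (c8 X subset_rfl h')
    refine ⟨2, 6, rfl, ?_⟩
    norm_num [splitWeight, slack] at this ⊢
    linarith
  · have := hb _ (c9 X subset_rfl h')
    refine ⟨3, 6, rfl, ?_⟩
    norm_num [splitWeight, slack] at this ⊢
    linarith

lemma path_add_cross_le {X : Finset V} (hpair : ∀ Y ⊆ X, Y.card = 2 → pairSum c Y ≤ 1)
    (htriple : ∀ Y ⊆ X, Y.card = 3 → pairSum c Y ≤ 2)
    (hquad : ∀ Y ⊆ X, Y.card = 4 → pairSum c Y ≤ 3)
    {u v x y : V} (hu : u ∈ X) (hv : v ∈ X) (hx : x ∈ X) (hy : y ∈ X)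
    (huv : u ≠ v) (hux : u ≠ x) (huy : u ≠ y) (hvx : v ≠ x) (hvy : v ≠ y) (hxy : x ≠ y)
    (cuv : c {u, v} = 1) (cvx : c {v, x} = 1) (cxy : c {x, y} = 1)
    (cux : c {u, x} = 0) (cvy : c {v, y} = 0) (cuy : c {u, y} = 0) :
    (∃ S ⊆ X, S.card = 5 ∧
      pairSum c S + ∑ z ∈ X \ S, ∑ s ∈ S, c {z, s} ≤ 5 + (X \ S).card) ∨
    (∃ S ⊆ X, S.card = 4 ∧
      pairSum c S + ∑ z ∈ X \ S, ∑ s ∈ S, c {z, s} ≤ 3 + (X \ S).card) := by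
  have P : ∀ a ∈ X, ∀ b ∈ X, a ≠ b → c {a, b} ≤ 1 := fun a ha b hb hab => by
    rw [← pairSum_pair c hab]
    exact hpair _ (by simp [Finset.insert_subset_iff, *]) (Finset.card_pair hab)
  have T : ∀ a ∈ X, ∀ b ∈ X, ∀ d ∈ X, a ≠ b → a ≠ d → b ≠ d →
      c {b, d} + (c {a, b} + c {a, d}) ≤ 2 := fun a ha b hb d hd hab had hbd => by
    rw [← pairSum_triple c hab had hbd]
    exact htriple _ (by simp [Finset.insert_subset_iff, *])
      (Finset.card_eq_three.2 ⟨a, b, d, hab, had, hbd, rfl⟩)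
  have Q : ∀ a ∈ X, ∀ b ∈ X, ∀ d ∈ X, ∀ e ∈ X, a ≠ b → a ≠ d → a ≠ e → b ≠ d → b ≠ e → d ≠ e →
      c {d, e} + (c {b, d} + c {b, e}) + (c {a, b} + (c {a, d} + c {a, e})) ≤ 3 :=
    fun a ha b hb d hd e he hab had hae hbd hbe hde => by
      rw [← pairSum_quad c hab had hae hbd hbe hde]
      refine hquad _ (by simp [Finset.insert_subset_iff, *]) ?_
      simp [Finset.card_insert_of_notMem, *]
  have sum4 : ∀ a : V, ∑ s ∈ ({u, v, x, y} : Finset V), c {a, s} =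
      c {a, u} + (c {a, v} + (c {a, x} + c {a, y})) := fun a => by
    rw [Finset.sum_insert (by simp [*]), Finset.sum_insert (by simp [*]), Finset.sum_pair hxy]
  have hSX : ({u, v, x, y} : Finset V) ⊆ X := by simp [Finset.insert_subset_iff, *]
  have hScard : ({u, v, x, y} : Finset V).card = 4 := by
    simp [Finset.card_insert_of_notMem, *]
  have cS : pairSum c {u, v, x, y} = 3 := by
    rw [pairSum_quad c huv hux huy hvx hvy hxy]
    omega
  by_cases hw : ∃ w ∈ X \ {u, v, x, y}, 2 ≤ ∑ s ∈ ({u, v, x, y} : Finset V), c {w, s}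
  · left
    obtain ⟨w, hwX, hw2⟩ := hw
    obtain ⟨hwX, hwS⟩ := Finset.mem_sdiff.1 hwX
    have hne := hwS
    simp only [Finset.mem_insert, Finset.mem_singleton, not_or] at hne
    obtain ⟨hwu, hwv, hwx, hwy⟩ := hne
    have w1 := P w hwX u hu hwu
    have w2 := P w hwX y hy hwy
    have w3 := T w hwX u hu v hv hwu hwv huv
    have w4 := T w hwX x hx y hy hwx hwy hxy
    have w5 := Q w hwX u hu v hv x hx hwu hwv hwx huv hux hvx
    have w6 := Q w hwX v hv x hx y hy hwv hwx hwy hvx hvy hxy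
    rw [sum4] at hw2
    have cwu : c {w, u} = 1 := by omega
    have cwy : c {w, y} = 1 := by omega
    have cwv : c {w, v} = 0 := by omega
    have cwx : c {w, x} = 0 := by omega
    refine ⟨insert w {u, v, x, y}, Finset.insert_subset hwX hSX, by
      rw [Finset.card_insert_of_notMem hwS, hScard], ?_⟩
    have h1 : ∑ z ∈ X \ insert w {u, v, x, y}, ∑ s ∈ insert w {u, v, x, y}, c {z, s} ≤
        (X \ insert w {u, v, x, y}).card • (1 : ℤ) := by
      refine Finset.sum_le_card_nsmul _ _ _ fun z hz => ?_
      rw [Finset.sum_insert hwS, sum4]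
      simp only [Finset.mem_sdiff, Finset.mem_insert, Finset.mem_singleton, not_or] at hz
      obtain ⟨hz, hzw, hzu, hzv, hzx, hzy⟩ := hz
      have t1 := T z hz w hwX u hu hzw hzu hwu
      have t2 := T z hz u hu v hv hzu hzv huv
      have t3 := T z hz v hv x hx hzv hzx hvx
      have t4 := T z hz x hx y hy hzx hzy hxy
      have t5 := T z hz w hwX y hy hzw hzy hwy
      have q1 := Q z hz w hwX u hu v hv hzw hzu hzv hwu hwv huv
      have q2 := Q z hz u hu v hv x hx hzu hzv hzx huv hux hvx
      have q3 := Q z hz v hv x hx y hy hzv hzx hzy hvx hvy hxy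
      have q4 := Q z hz w hwX x hx y hy hzw hzx hzy hwx hwy hxy
      have q5 := Q z hz w hwX u hu y hy hzw hzu hzy hwu hwy huy
      omega
    rw [nsmul_eq_mul, mul_one] at h1
    rw [pairSum_insert c hwS, cS, sum4]
    linarith
  · right
    refine ⟨{u, v, x, y}, hSX, hScard, ?_⟩
    have h1 : ∑ z ∈ X \ {u, v, x, y}, ∑ s ∈ ({u, v, x, y} : Finset V), c {z, s} ≤
        (X \ {u, v, x, y}).card • (1 : ℤ) :=
      Finset.sum_le_card_nsmul _ _ _ fun z hz => by
        by_contra hlt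
        exact hw ⟨z, hz, by omega⟩
    rw [nsmul_eq_mul, mul_one] at h1
    linarith

lemma exists_removable_or_isLocallySparse {X : Finset V} (hX : 10 ≤ X.card)
    (hc : ∀ Y ⊆ X, Y.card = 5 → pairSum c Y ≤ 5) :
    IsLocallySparse c X ∨ ∃ S ⊆ X, ∃ W : ℕ,
      pairSum c S + ∑ z ∈ X \ S, ∑ s ∈ S, c {z, s} ≤ W ∧
      (S.card = 2 ∧ W = 2 ∨ S.card = 3 ∧ W = 3 ∨ S.card = 4 ∧ W = X.card ∨
        S.card = 5 ∧ W = X.card) := by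
  by_cases h4 : ∃ S ⊆ X, S.card = 4 ∧ 4 ≤ pairSum c S
  · obtain ⟨S, hS, hk, hr⟩ := h4
    have e := Finset.card_sdiff_add_card_eq_card hS
    have := pairSum_add_cross_le hc hS hk hr (by omega)
    exact Or.inr ⟨S, hS, X.card, by push_cast [← e]; omega, by omega⟩
  have hquad : ∀ Y ⊆ X, Y.card = 4 → pairSum c Y ≤ 3 := fun Y hY hk => by
    by_contra hlt
    exact h4 ⟨Y, hY, hk, by omega⟩
  by_cases h3 : ∃ S ⊆ X, S.card = 3 ∧ 3 ≤ pairSum c S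
  · obtain ⟨S, hS, hk, hr⟩ := h3
    have e := Finset.card_sdiff_add_card_eq_card hS
    have := pairSum_add_cross_le hquad hS hk hr (by omega)
    exact Or.inr ⟨S, hS, 3, by push_cast; omega, by omega⟩
  have htriple : ∀ Y ⊆ X, Y.card = 3 → pairSum c Y ≤ 2 := fun Y hY hk => by
    by_contra hlt
    exact h3 ⟨Y, hY, hk, by omega⟩
  by_cases h2 : ∃ S ⊆ X, S.card = 2 ∧ 2 ≤ pairSum c S
  · obtain ⟨S, hS, hk, hr⟩ := h2
    have e := Finset.card_sdiff_add_card_eq_card hS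
    have := pairSum_add_cross_le htriple hS hk hr (by omega)
    exact Or.inr ⟨S, hS, 2, by push_cast; omega, by omega⟩
  have hpair : ∀ Y ⊆ X, Y.card = 2 → pairSum c Y ≤ 1 := fun Y hY hk => by
    by_contra hlt
    exact h2 ⟨Y, hY, hk, by omega⟩
  by_cases hS : ∃ S ⊆ X, ∃ W : ℕ,
      pairSum c S + ∑ z ∈ X \ S, ∑ s ∈ S, c {z, s} ≤ W ∧
      (S.card = 2 ∧ W = 2 ∨ S.card = 3 ∧ W = 3 ∨ S.card = 4 ∧ W = X.card ∨
        S.card = 5 ∧ W = X.card)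
  · exact Or.inr hS
  left
  constructor
  · intro a ha b hb hab
    rw [← pairSum_pair c hab]
    exact hpair _ (by simp [Finset.insert_subset_iff, *]) (Finset.card_pair hab)
  · intro a ha b hb d hd hab had hbd
    rw [← pairSum_triple c hab had hbd]
    exact htriple _ (by simp [Finset.insert_subset_iff, *])
      (Finset.card_eq_three.2 ⟨a, b, d, hab, had, hbd, rfl⟩)
  · intro a ha b hb d hd e he hab had hae hbd hbe hde
    rw [← pairSum_quad c hab had hae hbd hbe hde]
    refine hquad _ (by simp [Finset.insert_subset_iff, *]) ?_
    simp [Finset.card_insert_of_notMem, *]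
  · intro u hu v hv x hx y hy huv hux huy hvx hvy hxy cuv cvx cxy cux cvy cuy
    refine hS ?_
    rcases path_add_cross_le hpair htriple hquad hu hv hx hy huv hux huy hvx hvy hxy
      cuv cvx cxy cux cvy cuy with ⟨S, hS, hk, hle⟩ | ⟨S, hS, hk, hle⟩
    · have e := Finset.card_sdiff_add_card_eq_card hS
      exact ⟨S, hS, X.card, by push_cast [← e]; omega, by omega⟩
    · have e := Finset.card_sdiff_add_card_eq_card hS
      exact ⟨S, hS, X.card, by push_cast [← e]; omega, by omega⟩

theorem pairSum_le_splitWeight_add_slack (h : IsLogWeight c lam α β) :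
    ∀ (n : ℕ) (X : Finset V), X.card = n → 5 ≤ n →
      (∀ Y ⊆ X, Y.card = 5 → pairSum c Y ≤ 5) →
      ∃ x y : ℕ, x + y = n ∧ 8 * pairSum lam X ≤ 8 * splitWeight α β x y + α * slack n := by
  intro n
  induction n using Nat.strong_induction_on with
  | _ n ih =>
    rintro X rfl h5 hc
    rcases Nat.lt_or_ge X.card 10 with h9 | h10
    · exact pairSum_le_of_card_le_nine h h5 (by omega) hc
    have hα := h.pos
    have hβ := h.four_mul_le
    rcases exists_removable_or_isLocallySparse h10 hc with hR | ⟨S, hS, W, hW, hcases⟩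
    · obtain ⟨x, y, hxy, hle⟩ := pairSum_le_splitWeight_of_isLocallySparse h X.card X rfl hR
      refine ⟨x, y, hxy, ?_⟩
      have : 0 ≤ α * slack X.card := mul_nonneg hα.le (Nat.cast_nonneg _)
      linarith
    have hcard := Finset.card_sdiff_add_card_eq_card hS
    obtain ⟨x', y', hxy', hle'⟩ := ih (X \ S).card (by omega) (X \ S) rfl (by omega)
      fun Y hY => hc Y (hY.trans Finset.sdiff_subset)
    obtain ⟨x, y, hxy, hmax, hx⟩ := exists_max_splitWeight hα hβ (X \ S).card
    have hle : 8 * pairSum lam X ≤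
        8 * splitWeight α β x y + α * slack (X \ S).card + 8 * (α * W) := by
      have h1 := pairSum_le_of_subset h hS hW
      push_cast at h1
      linarith [hmax x' y' hxy']
    have hsl : ∀ m, slack m = min (2 * m) (120 - m) := fun _ => rfl
    rcases hcases with ⟨hk, hWk⟩ | ⟨hk, hWk⟩ | ⟨hk, hWk⟩ | ⟨hk, hWk⟩
    · exact ⟨x, y + 2, by omega,
        hle.trans (splitWeight_add_right_le hα (by simp only [hsl]; omega))⟩
    · exact ⟨x, y + 3, by omega,
        hle.trans (splitWeight_add_right_le hα (by simp only [hsl]; omega))⟩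
    · exact ⟨x + 1, y + 3, by omega,
        hle.trans (splitWeight_succ_add_le hα hβ (by simp only [hsl]; omega))⟩
    · exact ⟨x + 1, y + 4, by omega,
        hle.trans (splitWeight_succ_add_le hα hβ (by simp only [hsl]; omega))⟩

end Abstract

lemma pairSum_eq_of_split {V M : Type*} [DecidableEq V] [AddCommMonoid M] {g : Finset V → M}
    {X : Finset V} {P : V → Prop} [DecidablePred P] {A B C : M}
    (hA : ∀ u v, u ≠ v → P u → P v → g {u, v} = A)
    (hB : ∀ u v, u ≠ v → ¬ P u → ¬ P v → g {u, v} = B)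
    (hC : ∀ u v, ¬ P u → P v → g {u, v} = C) :
    pairSum g X = (X.filter P).card.choose 2 • A + (X.filter (¬ P ·)).card.choose 2 • B +
      ((X.filter (¬ P ·)).card * (X.filter P).card) • C := by
  conv_lhs => rw [← Finset.filter_union_filter_not_eq P X]
  rw [pairSum_union g (Finset.disjoint_filter_filter_not X X P),
    pairSum_const (A := A), pairSum_const (A := B)]
  · congr 1
    rw [Finset.sum_congr rfl (g := fun _ => (X.filter P).card • C), Finset.sum_const, mul_smul]
    intro y hy
    rw [Finset.sum_congr rfl (g := fun _ => C), Finset.sum_const]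
    intro x hx
    exact hC y x (Finset.mem_filter.1 hy).2 (Finset.mem_filter.1 hx).2
  · intro u hu v hv huv
    exact hB u v huv (Finset.mem_filter.1 hu).2 (Finset.mem_filter.1 hv).2
  · intro u hu v hv huv
    exact hA u v huv (Finset.mem_filter.1 hu).2 (Finset.mem_filter.1 hv).2

section Logarithms

variable {a : ℕ}

lemma log_succ_sub_log_le {j k : ℕ} (hj : 0 < j) (hjk : j ≤ k) :
    Real.log (k + 1) - Real.log k ≤ Real.log (j + 1) - Real.log j := by
  have hj' : (0 : ℝ) < j := by exact_mod_cast hj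
  have hjk' : (j : ℝ) ≤ k := by exact_mod_cast hjk
  have hk' : (0 : ℝ) < k := hj'.trans_le hjk'
  rw [← Real.log_div (by positivity) (by positivity),
    ← Real.log_div (by positivity) (by positivity)]
  refine Real.log_le_log (by positivity) ?_
  rw [div_le_div_iff₀ hk' hj']
  linarith

lemma log_sub_log_le (ha : 0 < a) {k : ℕ} (hk : 0 < k) :
    Real.log k - Real.log a ≤ (Real.log (a + 1) - Real.log a) * (k - a) := by
  rcases le_total a k with h | h
  · induction k, h using Nat.le_induction with
    | base => simp
    | succ j hj ih =>
      have h1 := ih (by omega)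
      have h2 := log_succ_sub_log_le ha hj
      push_cast
      linarith
  · have key : ∀ j, k ≤ j → j ≤ a →
        (Real.log (a + 1) - Real.log a) * (j - k) ≤ Real.log j - Real.log k := by
      intro j hj
      induction j, hj using Nat.le_induction with
      | base => simp
      | succ j hj ih =>
        intro hja
        have h1 := ih (by omega)
        have h2 := log_succ_sub_log_le (hk.trans_le hj) (by omega : j ≤ a)
        push_cast
        linarith
    linarith [key a h le_rfl]

lemma four_mul_log_sub_le (ha : 2 ≤ a) :
    4 * (Real.log a - Real.log ((a - 1 : ℕ) : ℝ)) ≤ 7 * (Real.log (a + 1) - Real.log a) := by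
  obtain ⟨b, rfl⟩ := Nat.exists_eq_add_of_le ha
  have e : 2 + b - 1 = b + 1 := by omega
  rw [e]
  have hpoly : (2 + b) ^ 11 ≤ (2 + b + 1) ^ 7 * (b + 1) ^ 4 := by
    rw [← sub_nonneg.trans (Nat.cast_le (α := ℤ))]
    push_cast
    ring_nf
    positivity
  have hpoly' : ((2 + b : ℕ) : ℝ) ^ 11 ≤ ((2 + b : ℕ) + 1 : ℝ) ^ 7 * ((b + 1 : ℕ) : ℝ) ^ 4 := by
    exact_mod_cast hpoly
  have hl := Real.log_le_log (by positivity) hpoly'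
  rw [Real.log_mul (by positivity) (by positivity), Real.log_pow, Real.log_pow, Real.log_pow] at hl
  push_cast at hl ⊢
  linarith

lemma isLogWeight_log {V : Type*} (ha : 2 ≤ a) {w : Finset V → ℕ} (hw : ∀ p, 0 < w p) :
    IsLogWeight (fun p => (w p : ℤ) - a) (fun p => Real.log (w p) - Real.log a)
      (Real.log (a + 1) - Real.log a) (Real.log a - Real.log ((a - 1 : ℕ) : ℝ)) where
  pos := by
    have : (0 : ℝ) < a := by exact_mod_cast (by omega)
    exact sub_pos.2 (Real.log_lt_log this (by linarith))
  le := by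
    have h := log_succ_sub_log_le (j := a - 1) (k := a) (by omega) (by omega)
    have e : ((a - 1 : ℕ) : ℝ) + 1 = a := by exact_mod_cast (by omega)
    rwa [e] at h
  four_mul_le := four_mul_log_sub_le ha
  lam_le p := by
    push_cast
    exact log_sub_log_le (by omega) (hw p)
  lam_le_neg p hp := by
    have h1 : (w p : ℝ) ≤ (a - 1 : ℕ) := by exact_mod_cast (by omega)
    have h2 := Real.log_le_log (by exact_mod_cast hw p) h1
    linarith

end Logarithms

section Patterns

variable {n a : ℕ}

lemma log_edgeProd {w : Finset (Fin n) → ℕ} (hw : ∀ p, 0 < w p) (X : Finset (Fin n)) :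
    Real.log (edgeProd n w X) = pairSum (fun p => Real.log (w p)) X := by
  unfold edgeProd pairSum
  push_cast
  exact Real.log_prod fun p _ => by exact_mod_cast (hw p).ne'

lemma InT.values {w : Finset (Fin n) → ℕ} (h : InT n 2 1 a w) :
    ∃ f : Fin n → ℕ, (∀ u v, u ≠ v → f u = 0 → f v = 0 → w {u, v} = a - 1) ∧
      (∀ u v, u ≠ v → ¬ f u = 0 → ¬ f v = 0 → w {u, v} = a) ∧
      (∀ u v, ¬ f u = 0 → f v = 0 → w {u, v} = a + 1) := by
  obtain ⟨f, hf, hw⟩ := h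
  refine ⟨f, fun u v huv hu hv => ?_, fun u v huv hu hv => ?_, fun u v hu hv => ?_⟩
  · rw [hw u v huv, hu, hv]
    simp
  · have h1 := hf u
    have h2 := hf v
    rw [hw u v huv, if_pos (by omega), if_neg hu]
  · have huv : u ≠ v := by
      rintro rfl
      exact hu hv
    rw [hw u v huv, if_neg (by omega)]

lemma InT.isF (ha : 2 ≤ a) {w : Finset (Fin n) → ℕ} (h : InT n 2 1 a w) :
    IsF n 5 (10 * a + 5) w := by
  obtain ⟨f, h0, h1, h2⟩ := h.values
  intro X hX
  have e : edgeSum n w X = _ := pairSum_eq_of_split (P := fun v => f v = 0) (X := X) h0 h1 h2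
  have hc := Finset.card_filter_add_card_filter_not (s := X) (fun v => f v = 0)
  rw [hX] at hc
  rw [e]
  generalize (X.filter (fun v => f v = 0)).card = k at hc ⊢
  generalize (X.filter (fun v => ¬ f v = 0)).card = l at hc ⊢
  obtain rfl : l = 5 - k := by omega
  have hk : k ≤ 5 := by omega
  simp only [smul_eq_mul]
  interval_cases k <;> norm_num [Nat.choose] <;> omega

/-- The member of `T_{2,1}(a,n)` whose first part consists of the first `x` vertices. -/
def splitGraph (n a x : ℕ) (p : Finset (Fin n)) : ℕ :=
  if (p.filter (fun v => v.val < x)).card = 2 then a - 1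
  else if (p.filter (fun v => v.val < x)).card = 1 then a + 1 else a

lemma splitGraph_pair {x : ℕ} {u v : Fin n} (huv : u ≠ v) :
    splitGraph n a x {u, v} = if u.val < x then (if v.val < x then a - 1 else a + 1)
      else (if v.val < x then a + 1 else a) := by
  unfold splitGraph
  rw [Finset.filter_insert, Finset.filter_singleton]
  split_ifs <;> simp_all

lemma splitGraph_pos (ha : 2 ≤ a) (x : ℕ) (p : Finset (Fin n)) : 0 < splitGraph n a x p := by
  unfold splitGraph
  split_ifs <;> omega

lemma inT_splitGraph (n a x : ℕ) : InT n 2 1 a (splitGraph n a x) := by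
  refine ⟨fun v => if v.val < x then 0 else 1, fun v => by dsimp only; split_ifs <;> omega,
    fun u v huv => ?_⟩
  rw [splitGraph_pair huv]
  by_cases hu : u.val < x <;> by_cases hv : v.val < x <;> simp [hu, hv]

lemma pairSum_log_splitGraph {x y : ℕ} (hxy : x + y = n) :
    pairSum (fun p => Real.log (splitGraph n a x p) - Real.log a) Finset.univ =
      splitWeight (Real.log (a + 1) - Real.log a)
        (Real.log a - Real.log ((a - 1 : ℕ) : ℝ)) x y := by
  rw [pairSum_eq_of_split (P := fun v : Fin n => v.val < x)
    (A := Real.log ((a - 1 : ℕ) : ℝ) - Real.log a) (B := 0) (C := Real.log (a + 1) - Real.log a)]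
  · have h1 : (Finset.univ.filter (fun v : Fin n => v.val < x)).card = x := by
      rw [Fin.card_filter_val_lt]
      omega
    have hc := Finset.card_filter_add_card_filter_not (s := Finset.univ)
      (fun v : Fin n => v.val < x)
    rw [h1, Finset.card_univ, Fintype.card_fin] at hc
    have h2 : (Finset.univ.filter (fun v : Fin n => ¬ v.val < x)).card = y := by omega
    rw [h1, h2]
    simp only [nsmul_eq_mul, Nat.cast_choose_two, splitWeight]
    push_cast
    ring
  · intro u v huv hu hv
    rw [splitGraph_pair huv, if_pos hu, if_pos hv]
  · intro u v huv hu hv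
    rw [splitGraph_pair huv, if_neg hu, if_neg hv, sub_self]
  · intro u v hu hv
    have huv : u ≠ v := by
      rintro rfl
      exact hu hv
    rw [splitGraph_pair huv, if_neg hu, if_pos hv]
    push_cast
    rfl

lemma exists_inT_edgeProd_le_of_pos (ha : 2 ≤ a) (hn : 120 ≤ n) {w : Finset (Fin n) → ℕ}
    (hpos : ∀ p, 0 < w p) (hw : IsF n 5 (10 * a + 5) w) :
    ∃ w', InT n 2 1 a w' ∧ edgeProd n w Finset.univ ≤ edgeProd n w' Finset.univ := by
  have hlog := isLogWeight_log ha hpos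
  have hc : ∀ Y ⊆ (Finset.univ : Finset (Fin n)), Y.card = 5 →
      pairSum (fun p => (w p : ℤ) - a) Y ≤ 5 := by
    intro Y _ hY
    have h1 := hw Y hY
    have h2 : pairSum (fun p => (w p : ℤ) - a) Y = (edgeSum n w Y : ℤ) - 10 * a := by
      unfold pairSum edgeSum
      rw [Finset.sum_sub_distrib, Finset.sum_const, Finset.card_powersetCard, hY]
      push_cast
      norm_num [Nat.choose]
    rw [h2]
    push_cast [← Nat.cast_le (α := ℤ)] at h1
    linarith
  obtain ⟨x, y, hxy, hle⟩ := pairSum_le_splitWeight_add_slack hlog n Finset.univ (by simp)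
    (by omega) hc
  have hs : slack n = 0 := by unfold slack; omega
  rw [hs, ← pairSum_log_splitGraph hxy] at hle
  refine ⟨splitGraph n a x, inT_splitGraph n a x, ?_⟩
  have hlogle : Real.log (edgeProd n w Finset.univ) ≤
      Real.log (edgeProd n (splitGraph n a x) Finset.univ) := by
    rw [log_edgeProd hpos, log_edgeProd (splitGraph_pos ha x)]
    simp only [pairSum, Finset.sum_sub_distrib] at hle ⊢
    push_cast at hle
    linarith
  have hp : ∀ v : Finset (Fin n) → ℕ, (∀ p, 0 < v p) →
      (0 : ℝ) < edgeProd n v Finset.univ := fun v hv => by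
    exact_mod_cast Finset.prod_pos fun p _ => hv p
  exact_mod_cast (Real.log_le_log_iff (hp _ hpos) (hp _ (splitGraph_pos ha x))).1 hlogle

lemma exists_inT_edgeProd_le (ha : 2 ≤ a) (hn : 120 ≤ n) {w : Finset (Fin n) → ℕ}
    (hw : IsF n 5 (10 * a + 5) w) :
    ∃ w', InT n 2 1 a w' ∧ edgeProd n w Finset.univ ≤ edgeProd n w' Finset.univ := by
  by_cases h0 : edgeProd n w Finset.univ = 0
  · exact ⟨splitGraph n a 0, inT_splitGraph n a 0, by omega⟩
  have hmax : ∀ p : Finset (Fin n), p.card = 2 → max (w p) 1 = w p := by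
    intro p hp
    have : w p ≠ 0 := Finset.prod_ne_zero_iff.1 h0 p
      (Finset.mem_powersetCard.2 ⟨Finset.subset_univ p, hp⟩)
    omega
  have hF : IsF n 5 (10 * a + 5) (fun p => max (w p) 1) := by
    intro X hX
    rw [edgeSum, Finset.sum_congr rfl fun p hp => hmax p (Finset.mem_powersetCard.1 hp).2]
    exact hw X hX
  obtain ⟨w', hw', hle⟩ := exists_inT_edgeProd_le_of_pos ha hn (fun p => by simp) hF
  rw [edgeProd, Finset.prod_congr rfl fun p hp => hmax p (Finset.mem_powersetCard.1 hp).2] at hle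
  exact ⟨w', hw', hle⟩

lemma bddAbove_inT_edgeProd (n a : ℕ) :
    BddAbove {P | ∃ w : Finset (Fin n) → ℕ, InT n 2 1 a w ∧ P = edgeProd n w Finset.univ} := by
  refine ⟨(a + 1) ^ ((Finset.univ : Finset (Fin n)).powersetCard 2).card, ?_⟩
  rintro P ⟨w, ⟨f, -, hw⟩, rfl⟩
  refine Finset.prod_le_pow_card _ _ _ fun p hp => ?_
  obtain ⟨u, v, huv, rfl⟩ := Finset.card_eq_two.1 (Finset.mem_powersetCard.1 hp).2
  rw [hw u v huv]
  split_ifs <;> omega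

end Patterns

/-- For all integers `a ≥ 2` and `n ≥ 124`,
`ex_Π(n, 5, 10a + 5) = Π_{2,1}(a, n)`. -/
theorem exPi_five (a n : ℕ) (ha : 2 ≤ a) (hn : 124 ≤ n) :
    exPi n 5 (10 * a + 5) = PiT 2 1 a n := by
  have hle : ∀ P ∈ {P | ∃ w : Finset (Fin n) → ℕ, IsF n 5 (10 * a + 5) w ∧
      P = edgeProd n w Finset.univ}, P ≤ PiT 2 1 a n := by
    rintro P ⟨w, hw, rfl⟩
    obtain ⟨w', hw', h⟩ := exists_inT_edgeProd_le ha (by omega) hw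
    exact h.trans (le_csSup (bddAbove_inT_edgeProd n a) ⟨w', hw', rfl⟩)
  have hsplit := inT_splitGraph n a 0
  refine le_antisymm (csSup_le ⟨_, _, hsplit.isF ha, rfl⟩ hle)
    (csSup_le ⟨_, _, hsplit, rfl⟩ ?_)
  rintro P ⟨w, hw, rfl⟩
  exact le_csSup ⟨_, hle⟩ ⟨w, hw.isF ha, rfl⟩
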